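/- arXiv:2602.20457 — 2 statements merged into one kernel-verified Lean document; each statement's English description precedes it below -/
import Mathlib

section
/- Let X and Y be finite nonempty types, μ : X → [0,1] with Σ_x μ(x) = 1, ψ : X × Y → ℝ^d with ‖ψ(x,y)‖ ≤ B_ψ, θ_ref ∈ ℝ^d, and Θ ⊆ ℝ^d nonempty closed convex and bounded with D := sup_{θ∈Θ} ‖θ − θ_ref‖ < ∞. For θ ∈ ℝ^d define π_θ(y|x) := exp(⟪θ, ψ(x,y)⟫)/Σ_{y'} exp(⟪θ, ψ(x,y')⟫) and the robust penalty R(θ) := Σ_{x,y₁,y₂} μ(x)·π_θ(y₁|x)·π_θ(y₂|x)·|⟪θ − θ_ref, ψ(x,y₁) − ψ(x,y₂)⟫|. Then R is κ_R-weakly convex on Θ — i.e., θ ↦ R(θ) + (κ_R/2)‖θ‖² is convex on Θ — with κ_R = 16B_ψ² + 4D·B_ψ³. -/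
open scoped RealInnerProductSpace BigOperators

/-- The log-linear (softmax) policy `π_θ(y|x) = exp⟪θ, ψ(x,y)⟫ / Σ_{y'} exp⟪θ, ψ(x,y')⟫`. -/
noncomputable def softmaxPolicy {n : ℕ} {X Y : Type*} [Fintype Y]
    (ψ : X × Y → EuclideanSpace ℝ (Fin n)) (θ : EuclideanSpace ℝ (Fin n)) (x : X) (y : Y) : ℝ :=
  Real.exp ⟪θ, ψ (x, y)⟫ / ∑ y' : Y, Real.exp ⟪θ, ψ (x, y')⟫

/-- The robust penalty
`R(θ) = Σ_{x,y₁,y₂} μ(x) π_θ(y₁|x) π_θ(y₂|x) |⟪θ−θ_ref, ψ(x,y₁)−ψ(x,y₂)⟫|`. -/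
noncomputable def Rpen {n : ℕ} {X Y : Type*} [Fintype X] [Fintype Y] (μ : X → ℝ)
    (ψ : X × Y → EuclideanSpace ℝ (Fin n)) (θref θ : EuclideanSpace ℝ (Fin n)) : ℝ :=
  ∑ x : X, ∑ y₁ : Y, ∑ y₂ : Y,
    μ x * softmaxPolicy ψ θ x y₁ * softmaxPolicy ψ θ x y₂ *
      |⟪θ - θref, ψ (x, y₁) - ψ (x, y₂)⟫|

section SoftmaxLine

variable {Y : Type*} [Fintype Y]

/-- The softmax weights of the scores `u`. -/
noncomputable def softmaxWeight (u : Y → ℝ) (y : Y) : ℝ :=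
  Real.exp (u y) / ∑ y', Real.exp (u y')

/-- The softmax weights along the line of scores `α + t β`. -/
noncomputable def softmaxLine (α β : Y → ℝ) (y : Y) (t : ℝ) : ℝ :=
  softmaxWeight (fun y => α y + t * β y) y

lemma softmaxLine_nonneg (α β : Y → ℝ) (y : Y) (t : ℝ) : 0 ≤ softmaxLine α β y t := by
  unfold softmaxLine softmaxWeight; positivity

lemma sum_softmaxLine [Nonempty Y] (α β : Y → ℝ) (t : ℝ) : ∑ y, softmaxLine α β y t = 1 := by
  unfold softmaxLine softmaxWeight
  rw [← Finset.sum_div]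
  exact div_self (Finset.sum_pos (fun y _ => Real.exp_pos _) Finset.univ_nonempty).ne'

/-- The mean of `β` under the softmax weights along a line. -/
noncomputable def softmaxMean (α β : Y → ℝ) (t : ℝ) : ℝ := ∑ y, softmaxLine α β y t * β y

lemma hasDerivAt_softmaxLine [Nonempty Y] (α β : Y → ℝ) (y : Y) (t : ℝ) :
    HasDerivAt (softmaxLine α β y) (softmaxLine α β y t * (β y - softmaxMean α β t)) t := by
  have hexp (y : Y) : HasDerivAt (fun t => Real.exp (α y + t * β y))
      (Real.exp (α y + t * β y) * β y) t := by
    simpa using (((hasDerivAt_id t).mul_const (β y)).const_add (α y)).exp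
  have hpos : 0 < ∑ y, Real.exp (α y + t * β y) :=
    Finset.sum_pos (fun y _ => Real.exp_pos _) Finset.univ_nonempty
  refine ((hexp y).div (HasDerivAt.fun_sum fun y _ => hexp y) hpos.ne').congr_deriv ?_
  simp only [softmaxMean, softmaxLine, softmaxWeight, div_mul_eq_mul_div]
  rw [← Finset.sum_div]
  field_simp

/-- The derivative of `softmaxMean`, i.e. the variance of `β`. -/
noncomputable def softmaxVar (α β : Y → ℝ) (t : ℝ) : ℝ :=
  ∑ y, softmaxLine α β y t * (β y - softmaxMean α β t) * β y

lemma hasDerivAt_softmaxMean [Nonempty Y] (α β : Y → ℝ) (t : ℝ) :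
    HasDerivAt (softmaxMean α β) (softmaxVar α β t) t :=
  HasDerivAt.fun_sum fun y _ => (hasDerivAt_softmaxLine α β y t).mul_const (β y)

lemma abs_softmaxMean_le [Nonempty Y] {α β : Y → ℝ} {L : ℝ} (hβ : ∀ y, |β y| ≤ L) (t : ℝ) :
    |softmaxMean α β t| ≤ L := by
  calc |softmaxMean α β t| ≤ ∑ y, |softmaxLine α β y t * β y| := Finset.abs_sum_le_sum_abs _ _
    _ ≤ ∑ y, softmaxLine α β y t * L := by
      gcongr with y
      rw [abs_mul, abs_of_nonneg (softmaxLine_nonneg α β y t)]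
      exact mul_le_mul_of_nonneg_left (hβ y) (softmaxLine_nonneg α β y t)
    _ = L := by rw [← Finset.sum_mul, sum_softmaxLine, one_mul]

lemma softmaxVar_le [Nonempty Y] {α β : Y → ℝ} {L : ℝ} (hβ : ∀ y, |β y| ≤ L) (t : ℝ) :
    softmaxVar α β t ≤ L ^ 2 := by
  have hsq : ∑ y, softmaxLine α β y t * β y ^ 2 ≤ L ^ 2 := by
    calc ∑ y, softmaxLine α β y t * β y ^ 2 ≤ ∑ y, softmaxLine α β y t * L ^ 2 := by
          gcongr ∑ y, ?_ with y
          exact mul_le_mul_of_nonneg_left (sq_le_sq' (abs_le.1 (hβ y)).1 (abs_le.1 (hβ y)).2)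
            (softmaxLine_nonneg α β y t)
      _ = L ^ 2 := by rw [← Finset.sum_mul, sum_softmaxLine, one_mul]
  have hvar : softmaxVar α β t = ∑ y, softmaxLine α β y t * β y ^ 2 - softmaxMean α β t ^ 2 := by
    rw [sq (softmaxMean α β t)]
    nth_rewrite 2 [softmaxMean]
    rw [softmaxVar, Finset.mul_sum, ← Finset.sum_sub_distrib]
    exact Finset.sum_congr rfl fun y _ => by ring
  nlinarith [sq_nonneg (softmaxMean α β t)]

lemma convexOn_sum_softmaxLine_mul_add_sq [Nonempty Y] {α β : Y → ℝ} {L M : ℝ}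
    {g g' g'' : Y → Y → ℝ → ℝ} (hβ : ∀ y, |β y| ≤ L)
    (hg : ∀ y₁ y₂ t, HasDerivAt (g y₁ y₂) (g' y₁ y₂ t) t)
    (hg' : ∀ y₁ y₂ t, HasDerivAt (g' y₁ y₂) (g'' y₁ y₂ t) t)
    (hg_nonneg : ∀ y₁ y₂ t, 0 ≤ g y₁ y₂ t)
    (hg_le : ∀ y₁ y₂, ∀ t ∈ Set.Icc (0 : ℝ) 1, g y₁ y₂ t ≤ M)
    (hg'_le : ∀ y₁ y₂ t, |g' y₁ y₂ t| ≤ 2 * L)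
    (hg''_nonneg : ∀ y₁ y₂ t, 0 ≤ g'' y₁ y₂ t) :
    ConvexOn ℝ (Set.Icc 0 1) fun t =>
      (∑ y₁, ∑ y₂, softmaxLine α β y₁ t * softmaxLine α β y₂ t * g y₁ y₂ t) +
        (16 * L ^ 2 + 2 * M * L ^ 2) / 2 * t ^ 2 := by
  set p := softmaxLine α β
  set m := softmaxMean α β
  set V := softmaxVar α β
  set c := 16 * L ^ 2 + 2 * M * L ^ 2
  have hpp (y₁ y₂ : Y) (t : ℝ) : HasDerivAt (fun t => p y₁ t * p y₂ t)
      (p y₁ t * p y₂ t * (β y₁ + β y₂ - 2 * m t)) t :=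
    ((hasDerivAt_softmaxLine α β y₁ t).mul (hasDerivAt_softmaxLine α β y₂ t)).congr_deriv
      (by ring)
  have hs (y₁ y₂ : Y) (t : ℝ) :
      HasDerivAt (fun t => β y₁ + β y₂ - 2 * m t) (-(2 * V t)) t :=
    ((hasDerivAt_softmaxMean α β t).const_mul 2).const_sub _
  have hderiv (t : ℝ) : HasDerivAt
      (fun t => (∑ y₁, ∑ y₂, p y₁ t * p y₂ t * g y₁ y₂ t) + c / 2 * t ^ 2)
      ((∑ y₁, ∑ y₂, p y₁ t * p y₂ t * ((β y₁ + β y₂ - 2 * m t) * g y₁ y₂ t + g' y₁ y₂ t))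
        + c * t) t := by
    refine (HasDerivAt.fun_sum fun y₁ _ => HasDerivAt.fun_sum fun y₂ _ =>
      ((hpp y₁ y₂ t).mul (hg y₁ y₂ t)).congr_deriv ?_).add
        ((((hasDerivAt_id t).pow 2).const_mul (c / 2)).congr_deriv ?_)
    · ring
    · simp; ring
  have hderiv2 (t : ℝ) : HasDerivAt
      (fun t => (∑ y₁, ∑ y₂, p y₁ t * p y₂ t *
        ((β y₁ + β y₂ - 2 * m t) * g y₁ y₂ t + g' y₁ y₂ t)) + c * t)
      ((∑ y₁, ∑ y₂, p y₁ t * p y₂ t * ((β y₁ + β y₂ - 2 * m t) ^ 2 * g y₁ y₂ t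
        + 2 * ((β y₁ + β y₂ - 2 * m t) * g' y₁ y₂ t) - 2 * V t * g y₁ y₂ t + g'' y₁ y₂ t))
        + c) t := by
    refine (HasDerivAt.fun_sum fun y₁ _ => HasDerivAt.fun_sum fun y₂ _ =>
      ((hpp y₁ y₂ t).mul (((hs y₁ y₂ t).mul (hg y₁ y₂ t)).add (hg' y₁ y₂ t))).congr_deriv ?_).add
        (((hasDerivAt_id t).const_mul c).congr_deriv (mul_one c))
    simp only [Pi.mul_apply, Pi.add_apply]
    ring
  refine convexOn_of_hasDerivWithinAt2_nonneg (convex_Icc 0 1)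
    (fun t _ => (hderiv t).continuousAt.continuousWithinAt)
    (fun t _ => (hderiv t).hasDerivWithinAt) (fun t _ => (hderiv2 t).hasDerivWithinAt) ?_
  intro t ht
  have hterm (y₁ y₂ : Y) : -c ≤ (β y₁ + β y₂ - 2 * m t) ^ 2 * g y₁ y₂ t
        + 2 * ((β y₁ + β y₂ - 2 * m t) * g' y₁ y₂ t) - 2 * V t * g y₁ y₂ t + g'' y₁ y₂ t := by
    have hm := abs_le.1 (abs_softmaxMean_le (α := α) hβ t)
    have h₁ := abs_le.1 (hβ y₁)
    have h₂ := abs_le.1 (hβ y₂)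
    have hs_le : |β y₁ + β y₂ - 2 * m t| ≤ 4 * L :=
      abs_le.2 ⟨by linarith [hm.2], by linarith [hm.1]⟩
    have hsg : |(β y₁ + β y₂ - 2 * m t) * g' y₁ y₂ t| ≤ 4 * L * (2 * L) := by
      rw [abs_mul]
      exact mul_le_mul hs_le (hg'_le y₁ y₂ t) (abs_nonneg _) ((abs_nonneg _).trans hs_le)
    have hVg : V t * g y₁ y₂ t ≤ L ^ 2 * M :=
      mul_le_mul (softmaxVar_le hβ t) (hg_le y₁ y₂ t (interior_subset ht)) (hg_nonneg y₁ y₂ t)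
        (sq_nonneg L)
    have := mul_nonneg (sq_nonneg (β y₁ + β y₂ - 2 * m t)) (hg_nonneg y₁ y₂ t)
    simp only [c]
    linarith [(abs_le.1 hsg).1, hg''_nonneg y₁ y₂ t]
  have hsum : ∑ y₁, ∑ y₂, p y₁ t * p y₂ t * -c = -c := by
    simp_rw [← Finset.sum_mul, ← Finset.mul_sum]
    simp [p, sum_softmaxLine]
  have hge : -c ≤ ∑ y₁, ∑ y₂, p y₁ t * p y₂ t * ((β y₁ + β y₂ - 2 * m t) ^ 2 * g y₁ y₂ t
        + 2 * ((β y₁ + β y₂ - 2 * m t) * g' y₁ y₂ t) - 2 * V t * g y₁ y₂ t + g'' y₁ y₂ t) := by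
    rw [← hsum]
    exact Finset.sum_le_sum fun y₁ _ => Finset.sum_le_sum fun y₂ _ =>
      mul_le_mul_of_nonneg_left (hterm y₁ y₂)
        (mul_nonneg (softmaxLine_nonneg α β y₁ t) (softmaxLine_nonneg α β y₂ t))
  linarith

end SoftmaxLine

/-- A smooth convex approximation of `|z|` from below. -/
noncomputable def smoothAbs (ε z : ℝ) : ℝ := √(z ^ 2 + ε ^ 2) - ε

lemma smoothAbs_zero (z : ℝ) : smoothAbs 0 z = |z| := by
  simp [smoothAbs, Real.sqrt_sq_eq_abs]

lemma smoothAbs_nonneg (ε z : ℝ) : 0 ≤ smoothAbs ε z :=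
  sub_nonneg.2 (Real.le_sqrt_of_sq_le (by nlinarith [sq_nonneg z]))

lemma smoothAbs_le_abs {ε : ℝ} (hε : 0 ≤ ε) (z : ℝ) : smoothAbs ε z ≤ |z| := by
  rw [smoothAbs, sub_le_iff_le_add, Real.sqrt_le_left (by positivity)]
  nlinarith [sq_abs z, abs_nonneg z]

lemma hasDerivAt_sqrt_sq_add_sq {ε : ℝ} (hε : 0 < ε) (z : ℝ) :
    HasDerivAt (fun z => √(z ^ 2 + ε ^ 2)) (z / √(z ^ 2 + ε ^ 2)) z := by
  refine (((hasDerivAt_pow 2 z).add_const (ε ^ 2)).sqrt (by positivity)).congr_deriv ?_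
  field_simp
  norm_num

lemma hasDerivAt_smoothAbs {ε : ℝ} (hε : 0 < ε) (z : ℝ) :
    HasDerivAt (smoothAbs ε) (z / √(z ^ 2 + ε ^ 2)) z :=
  (hasDerivAt_sqrt_sq_add_sq hε z).sub_const ε

lemma hasDerivAt_div_sqrt_sq_add_sq {ε : ℝ} (hε : 0 < ε) (z : ℝ) :
    HasDerivAt (fun z => z / √(z ^ 2 + ε ^ 2)) (ε ^ 2 / √(z ^ 2 + ε ^ 2) ^ 3) z := by
  have hpos : 0 < √(z ^ 2 + ε ^ 2) := by positivity
  have hsq : √(z ^ 2 + ε ^ 2) ^ 2 = z ^ 2 + ε ^ 2 := Real.sq_sqrt (by positivity)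
  refine ((hasDerivAt_id z).div (hasDerivAt_sqrt_sq_add_sq hε z) hpos.ne').congr_deriv ?_
  simp only [id]
  field_simp
  rw [hsq]
  ring

lemma abs_div_sqrt_sq_add_sq_le_one (ε z : ℝ) : |z / √(z ^ 2 + ε ^ 2)| ≤ 1 := by
  rw [abs_div, abs_of_nonneg (Real.sqrt_nonneg _)]
  exact div_le_one_of_le₀ (Real.abs_le_sqrt (by nlinarith [sq_nonneg ε])) (Real.sqrt_nonneg _)

lemma ConvexOn.of_tendsto {E ι : Type*} [AddCommGroup E] [Module ℝ E] {s : Set E}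
    {l : Filter ι} [l.NeBot] {F : ι → E → ℝ} {f : E → ℝ} (hF : ∀ᶠ i in l, ConvexOn ℝ s (F i))
    (hlim : ∀ x ∈ s, Filter.Tendsto (fun i => F i x) l (nhds (f x))) : ConvexOn ℝ s f := by
  obtain ⟨i, hi⟩ := hF.exists
  refine ⟨hi.1, fun x hx y hy a b ha hb hab => ?_⟩
  exact le_of_tendsto_of_tendsto (hlim _ (hi.1 hx hy ha hb hab))
    (((hlim x hx).const_smul a).add ((hlim y hy).const_smul b))
    (hF.mono fun i hi => hi.2 hx hy ha hb hab)

lemma ConvexOn.finset_sum {E ι : Type*} [AddCommGroup E] [Module ℝ E] {s : Set E}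
    {I : Finset ι} {f : ι → E → ℝ} (hs : Convex ℝ s) (hf : ∀ i ∈ I, ConvexOn ℝ s (f i)) :
    ConvexOn ℝ s (∑ i ∈ I, f i) :=
  Finset.sum_induction f (ConvexOn ℝ s) (fun _ _ => ConvexOn.add) (convexOn_const 0 hs) hf

lemma ConvexOn.of_line {E : Type*} [AddCommGroup E] [Module ℝ E] {s : Set E} {f : E → ℝ}
    (hs : Convex ℝ s)
    (hf : ∀ x ∈ s, ∀ y ∈ s, ConvexOn ℝ (Set.Icc 0 1) fun t : ℝ => f (x + t • (y - x))) :
    ConvexOn ℝ s f := by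
  refine ⟨hs, fun x hx y hy a b ha hb hab => ?_⟩
  have h := (hf x hx y hy).2 (Set.left_mem_Icc.2 zero_le_one) (Set.right_mem_Icc.2 zero_le_one)
    ha hb hab
  have hxy : x + b • (y - x) = a • x + b • y := by
    rw [← eq_sub_iff_add_eq] at hab
    subst hab
    module
  simpa [hxy] using h

lemma convexOn_sum_softmaxLine_mul_abs_add_sq {Y : Type*} [Fintype Y] [Nonempty Y]
    {α β : Y → ℝ} {L M : ℝ} {a : Y → Y → ℝ} (hβ : ∀ y, |β y| ≤ L)
    (hM : ∀ y₁ y₂, ∀ t ∈ Set.Icc (0 : ℝ) 1, |a y₁ y₂ + t * (β y₁ - β y₂)| ≤ M) :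
    ConvexOn ℝ (Set.Icc 0 1) fun t =>
      (∑ y₁, ∑ y₂, softmaxLine α β y₁ t * softmaxLine α β y₂ t *
        |a y₁ y₂ + t * (β y₁ - β y₂)|) + (16 * L ^ 2 + 2 * M * L ^ 2) / 2 * t ^ 2 := by
  refine ConvexOn.of_tendsto (l := nhdsWithin 0 (Set.Ioi 0)) (F := fun ε t =>
    (∑ y₁, ∑ y₂, softmaxLine α β y₁ t * softmaxLine α β y₂ t *
        smoothAbs ε (a y₁ y₂ + t * (β y₁ - β y₂))) + (16 * L ^ 2 + 2 * M * L ^ 2) / 2 * t ^ 2)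
    ?_ fun t _ => ?_
  · filter_upwards [self_mem_nhdsWithin] with ε (hε : 0 < ε)
    have hlin (y₁ y₂ : Y) (t : ℝ) :
        HasDerivAt (fun t => a y₁ y₂ + t * (β y₁ - β y₂)) (β y₁ - β y₂) t := by
      simpa using ((hasDerivAt_id t).mul_const (β y₁ - β y₂)).const_add (a y₁ y₂)
    refine convexOn_sum_softmaxLine_mul_add_sq hβ
      (fun y₁ y₂ t => (hasDerivAt_smoothAbs hε _).comp t (hlin y₁ y₂ t))
      (fun y₁ y₂ t => ((hasDerivAt_div_sqrt_sq_add_sq hε _).comp t (hlin y₁ y₂ t)).mul_const _)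
      (fun y₁ y₂ t => smoothAbs_nonneg _ _)
      (fun y₁ y₂ t ht => (smoothAbs_le_abs hε.le _).trans (hM y₁ y₂ t ht))
      (fun y₁ y₂ t => ?_) (fun y₁ y₂ t => ?_)
    · have hle : |β y₁ - β y₂| ≤ 2 * L := by linarith [abs_sub (β y₁) (β y₂), hβ y₁, hβ y₂]
      rw [abs_mul]
      exact (mul_le_of_le_one_left (abs_nonneg _) (abs_div_sqrt_sq_add_sq_le_one _ _)).trans hle
    · rw [mul_assoc]
      exact mul_nonneg (by positivity) (mul_self_nonneg _)
  · simp_rw [← smoothAbs_zero]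
    refine Filter.Tendsto.mono_left (Continuous.tendsto ?_ 0) nhdsWithin_le_nhds
    unfold smoothAbs
    fun_prop

/-- Theorem 4.7, weak convexity of the robust penalty: `R` is `κ_R`-weakly
convex on `Θ` with `κ_R = 16B_ψ² + 4D B_ψ³`, i.e. `θ ↦ R(θ) + (κ_R/2)‖θ‖²` is convex on `Θ`. -/
theorem stmt8 {n : ℕ} {X Y : Type*} [Fintype X] [Fintype Y] [Nonempty X] [Nonempty Y]
    (μ : X → ℝ) (hμ : ∀ x, μ x ∈ Set.Icc (0 : ℝ) 1) (hμsum : ∑ x, μ x = 1)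
    (ψ : X × Y → EuclideanSpace ℝ (Fin n)) (Bψ : ℝ)
    (hB : ∀ x y, ‖ψ (x, y)‖ ≤ Bψ)
    (θref : EuclideanSpace ℝ (Fin n)) (Θ : Set (EuclideanSpace ℝ (Fin n)))
    (hne : Θ.Nonempty) (hcl : IsClosed Θ) (hconv : Convex ℝ Θ)
    (hbdd : Bornology.IsBounded Θ) (D : ℝ)
    (hD : IsLUB ((fun θ => ‖θ - θref‖) '' Θ) D) :
    ConvexOn ℝ Θ
      (fun θ => Rpen μ ψ θref θ + ((16 * Bψ ^ 2 + 4 * D * Bψ ^ 3) / 2) * ‖θ‖ ^ 2) := by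
  refine ConvexOn.of_line hconv fun θ₀ hθ₀ θ₁ hθ₁ => ?_
  set v := θ₁ - θ₀
  have hmem (t : ℝ) (ht : t ∈ Set.Icc (0 : ℝ) 1) : ‖θ₀ + t • v - θref‖ ≤ D :=
    hD.1 ⟨_, hconv.add_smul_sub_mem hθ₀ hθ₁ ht, rfl⟩
  have hinner (t : ℝ) (w : EuclideanSpace ℝ (Fin n)) :
      ⟪θ₀ + t • v, w⟫ = ⟪θ₀, w⟫ + t * ⟪v, w⟫ := by
    rw [inner_add_left, real_inner_smul_left]
  have hconvex (x : X) := convexOn_sum_softmaxLine_mul_abs_add_sq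
    (α := fun y => ⟪θ₀, ψ (x, y)⟫) (β := fun y => ⟪v, ψ (x, y)⟫) (L := Bψ * ‖v‖)
    (M := D * (2 * Bψ)) (a := fun y₁ y₂ => ⟪θ₀ - θref, ψ (x, y₁) - ψ (x, y₂)⟫)
    (fun y => (abs_real_inner_le_norm _ _).trans
      (by rw [mul_comm]; gcongr; exact hB x y))
    (fun y₁ y₂ t ht => by
      rw [← inner_sub_right, ← real_inner_smul_left, ← inner_add_left, sub_add_eq_add_sub]
      refine (abs_real_inner_le_norm _ _).trans (mul_le_mul (hmem t ht) ?_ (norm_nonneg _)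
        ((norm_nonneg _).trans (hmem t ht)))
      linarith [norm_sub_le (ψ (x, y₁)) (ψ (x, y₂)), hB x y₁, hB x y₂])
  set κ := 16 * Bψ ^ 2 + 4 * D * Bψ ^ 3
  have haffine : ConvexOn ℝ (Set.Icc (0 : ℝ) 1)
      fun t : ℝ => κ / 2 * ‖θ₀‖ ^ 2 + t * (κ * ⟪θ₀, v⟫) :=
    ⟨convex_Icc 0 1, fun s _ t _ a b _ _ hab => by
      simp only [smul_eq_mul]
      exact le_of_eq (by linear_combination -(κ / 2 * ‖θ₀‖ ^ 2) * hab)⟩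
  have hsum := ConvexOn.finset_sum (I := Finset.univ) (convex_Icc (0 : ℝ) 1)
    fun x _ => (hconvex x).smul (hμ x).1
  refine (hsum.add haffine).congr fun t _ => ?_
  simp only [Pi.add_apply, Finset.sum_apply, smul_eq_mul, mul_add, Finset.sum_add_distrib]
  rw [← Finset.sum_mul, hμsum, norm_add_sq_real, real_inner_smul_right, norm_smul, mul_pow ‖t‖,
    Real.norm_eq_abs, sq_abs, add_assoc]
  congr 1
  · simp only [Rpen, Finset.mul_sum]
    refine Finset.sum_congr rfl fun x _ => Finset.sum_congr rfl fun y₁ _ =>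
      Finset.sum_congr rfl fun y₂ _ => ?_
    simp only [softmaxPolicy, softmaxLine, softmaxWeight, hinner, ← mul_assoc]
    congr 2
    rw [← inner_sub_right, ← real_inner_smul_left, ← inner_add_left, sub_add_eq_add_sub]
  · simp only [κ]
    ring
end

section
/- Let X and Y be finite nonempty types, μ : X → [0,1] with Σ_x μ(x) = 1, ψ : X × Y → ℝ^d with ‖ψ(x,y)‖ ≤ B_ψ, θ_ref ∈ ℝ^d, and Θ ⊆ ℝ^d nonempty closed convex and bounded with D := sup_{θ∈Θ} ‖θ − θ_ref‖ < ∞. For θ ∈ ℝ^d define π_θ(y|x) := exp(⟪θ, ψ(x,y)⟫)/Σ_{y'} exp(⟪θ, ψ(x,y')⟫) and R(θ) := Σ_{x,y₁,y₂} μ(x)·π_θ(y₁|x)·π_θ(y₂|x)·|⟪θ − θ_ref, ψ(x,y₁) − ψ(x,y₂)⟫|. Then R is Lipschitz continuous on Θ with constant 2B_ψ + 8D·B_ψ²: for all θ, θ' ∈ Θ, |R(θ) − R(θ')| ≤ (2B_ψ + 8D·B_ψ²)·‖θ − θ'‖. -/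
open scoped RealInnerProductSpace BigOperators

/-- Perturbing the logits of a softmax by at most `c` changes it by at most `2 * c` in `ℓ¹`. -/
theorem sum_abs_softmax_sub_le {Y : Type*} [Fintype Y] [Nonempty Y] (a b : Y → ℝ) {c : ℝ}
    (h : ∀ y, |a y - b y| ≤ c) :
    ∑ y, |Real.exp (a y) / ∑ z, Real.exp (a z) - Real.exp (b y) / ∑ z, Real.exp (b z)|
      ≤ 2 * c := by
  have hs : ∀ x : ℝ, ∃ s : ℝ, |s| ≤ 1 ∧ |x| = s * x := fun x => by
    rcases abs_cases x with h | h
    · exact ⟨1, by simp, by linarith⟩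
    · exact ⟨-1, by simp, by linarith⟩
  choose s hs1 hs2 using fun y => hs
    (Real.exp (a y) / ∑ z, Real.exp (a z) - Real.exp (b y) / ∑ z, Real.exp (b z))
  let e : ℝ → Y → ℝ := fun t y => Real.exp (b y + t * (a y - b y))
  have he : ∀ t y, HasDerivAt (fun t => e t y) (e t y * (a y - b y)) t := fun t y => by
    simpa using (((hasDerivAt_id t).mul_const (a y - b y)).const_add (b y)).exp
  have hS : ∀ t, 0 < ∑ y, e t y := fun t =>
    Finset.sum_pos (fun y _ => Real.exp_pos _) Finset.univ_nonempty
  have hsum : ∀ (t k : ℝ) (g : Y → ℝ), (∀ y, |g y| ≤ k) →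
      |∑ y, g y * e t y| ≤ k * ∑ y, e t y := fun t k g hg => by
    rw [Finset.mul_sum]
    refine (Finset.abs_sum_le_sum_abs _ _).trans (Finset.sum_le_sum fun y _ => ?_)
    rw [abs_mul, abs_of_pos (Real.exp_pos _ : 0 < e t y)]
    exact mul_le_mul_of_nonneg_right (hg y) (Real.exp_pos _).le
  have hc : 0 ≤ c := (abs_nonneg _).trans (h (Classical.arbitrary Y))
  have hderiv : ∀ t, HasDerivAt (fun t => (∑ y, s y * e t y) / ∑ y, e t y)
      (((∑ y, s y * (e t y * (a y - b y))) * (∑ y, e t y)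
        - (∑ y, s y * e t y) * ∑ y, e t y * (a y - b y)) / (∑ y, e t y) ^ 2) t := fun t =>
    (HasDerivAt.fun_sum fun y _ => (he t y).const_mul (s y)).fun_div
      (HasDerivAt.fun_sum fun y _ => he t y) (hS t).ne'
  have hbound : ∀ t, ‖((∑ y, s y * (e t y * (a y - b y))) * (∑ y, e t y)
        - (∑ y, s y * e t y) * ∑ y, e t y * (a y - b y)) / (∑ y, e t y) ^ 2‖ ≤ 2 * c := by
    intro t
    have h1 : |∑ y, s y * (e t y * (a y - b y))| ≤ c * ∑ y, e t y := by
      have := hsum t c (fun y => s y * (a y - b y)) fun y => by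
        rw [abs_mul]
        exact (mul_le_of_le_one_left (abs_nonneg _) (hs1 y)).trans (h y)
      simpa only [mul_assoc, mul_comm (e t _)] using this
    have h2 : |∑ y, s y * e t y| ≤ ∑ y, e t y := by simpa using hsum t 1 s hs1
    have h3 : |∑ y, e t y * (a y - b y)| ≤ c * ∑ y, e t y := by
      simpa only [mul_comm] using hsum t c _ h
    rw [Real.norm_eq_abs, abs_div, abs_of_pos (pow_pos (hS t) 2), div_le_iff₀ (pow_pos (hS t) 2)]
    calc _ ≤ |∑ y, s y * (e t y * (a y - b y))| * (∑ y, e t y)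
          + |∑ y, s y * e t y| * |∑ y, e t y * (a y - b y)| := by
          refine (abs_sub _ _).trans_eq ?_
          rw [abs_mul, abs_mul, abs_of_pos (hS t)]
      _ ≤ (c * ∑ y, e t y) * (∑ y, e t y) + (∑ y, e t y) * (c * ∑ y, e t y) :=
          add_le_add (mul_le_mul_of_nonneg_right h1 (hS t).le)
            (mul_le_mul h2 h3 (abs_nonneg _) (hS t).le)
      _ = _ := by ring
  have key := convex_univ.norm_image_sub_le_of_norm_hasDerivWithin_le
    (fun t _ => (hderiv t).hasDerivWithinAt) (fun t _ => hbound t)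
    (Set.mem_univ (0 : ℝ)) (Set.mem_univ (1 : ℝ))
  refine le_trans (le_of_eq ?_) ((le_abs_self _).trans (key.trans_eq (by simp)))
  simp only [hs2, mul_sub, Finset.sum_sub_distrib, e, Finset.sum_div, mul_div_assoc]
  simp

/-- The expectations of `u` and `v` under the product laws `p ⊗ p` and `q ⊗ q` differ by at most
`‖u - v‖_∞ + 2 * ‖v‖_∞ * ‖p - q‖₁`. -/
theorem abs_sum_mul_sub_le {Y : Type*} [Fintype Y] (p q : Y → ℝ) (u v : Y → Y → ℝ)
    {L M T : ℝ} (hp : ∀ y, 0 ≤ p y) (hq : ∀ y, 0 ≤ q y) (hp1 : ∑ y, p y = 1)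
    (hq1 : ∑ y, q y = 1) (huv : ∀ y z, |u y z - v y z| ≤ L) (hv : ∀ y z, |v y z| ≤ M)
    (hM : 0 ≤ M) (hT : ∑ y, |p y - q y| ≤ T) :
    |∑ y, ∑ z, p y * p z * u y z - ∑ y, ∑ z, q y * q z * v y z| ≤ L + 2 * M * T := by
  have hterm : ∀ y z, |p y * p z * u y z - q y * q z * v y z| ≤
      p y * p z * L + (p y * |p z - q z| + |p y - q y| * q z) * M := fun y z => by
    have h : p y * p z * u y z - q y * q z * v y z = p y * p z * (u y z - v y z)
        + (p y * (p z - q z) + (p y - q y) * q z) * v y z := by ring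
    have h1 : |p y * (p z - q z) + (p y - q y) * q z| ≤ p y * |p z - q z| + |p y - q y| * q z := by
      refine (abs_add_le _ _).trans_eq ?_
      rw [abs_mul, abs_mul, abs_of_nonneg (hp y), abs_of_nonneg (hq z)]
    rw [h]
    refine (abs_add_le _ _).trans ?_
    rw [abs_mul, abs_mul _ (v y z), abs_of_nonneg (mul_nonneg (hp y) (hp z))]
    exact add_le_add (mul_le_mul_of_nonneg_left (huv y z) (mul_nonneg (hp y) (hp z)))
      (mul_le_mul h1 (hv y z) (abs_nonneg _) ((abs_nonneg _).trans h1))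
  calc _ = |∑ y, ∑ z, (p y * p z * u y z - q y * q z * v y z)| := by
        simp only [Finset.sum_sub_distrib]
    _ ≤ ∑ y, ∑ z, (p y * p z * L + (p y * |p z - q z| + |p y - q y| * q z) * M) :=
        (Finset.abs_sum_le_sum_abs _ _).trans (Finset.sum_le_sum fun y _ =>
          (Finset.abs_sum_le_sum_abs _ _).trans (Finset.sum_le_sum fun z _ => hterm y z))
    _ = L + 2 * M * ∑ y, |p y - q y| := by
        simp only [Finset.sum_add_distrib, ← Finset.sum_mul, ← Finset.mul_sum, hp1, hq1]
        ring
    _ ≤ _ := by gcongr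

/-- Step 3 of the proof of Lemma B.3: the robust penalty `R` is Lipschitz
on `Θ` with constant `2B_ψ + 8D B_ψ²`. -/
theorem stmt19 {n : ℕ} {X Y : Type*} [Fintype X] [Fintype Y] [Nonempty X] [Nonempty Y]
    (μ : X → ℝ) (hμ : ∀ x, μ x ∈ Set.Icc (0 : ℝ) 1) (hμsum : ∑ x, μ x = 1)
    (ψ : X × Y → EuclideanSpace ℝ (Fin n)) (Bψ : ℝ)
    (hB : ∀ x y, ‖ψ (x, y)‖ ≤ Bψ)
    (θref : EuclideanSpace ℝ (Fin n)) (Θ : Set (EuclideanSpace ℝ (Fin n)))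
    (hne : Θ.Nonempty) (hcl : IsClosed Θ) (hconv : Convex ℝ Θ)
    (hbdd : Bornology.IsBounded Θ) (D : ℝ)
    (hD : IsLUB ((fun θ => ‖θ - θref‖) '' Θ) D) :
    ∀ θ ∈ Θ, ∀ θ' ∈ Θ,
      |Rpen μ ψ θref θ - Rpen μ ψ θref θ'| ≤ (2 * Bψ + 8 * D * Bψ ^ 2) * ‖θ - θ'‖ := by
  intro θ hθ θ' hθ'
  have hB0 : 0 ≤ Bψ := (norm_nonneg _).trans (hB (Classical.arbitrary X) (Classical.arbitrary Y))
  have hD' : ‖θ' - θref‖ ≤ D := hD.1 ⟨θ', hθ', rfl⟩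
  have hD0 : 0 ≤ D := (norm_nonneg _).trans hD'
  have hdiff : ∀ x y z, ‖ψ (x, y) - ψ (x, z)‖ ≤ 2 * Bψ := fun x y z =>
    (norm_sub_le _ _).trans (by linarith [hB x y, hB x z])
  have hnonneg : ∀ η x y, 0 ≤ softmaxPolicy ψ η x y := fun η x y => by
    unfold softmaxPolicy; positivity
  have hone : ∀ η x, ∑ y, softmaxPolicy ψ η x y = 1 := fun η x => by
    unfold softmaxPolicy
    rw [← Finset.sum_div]
    exact div_self (Finset.sum_pos (fun y _ => Real.exp_pos _) Finset.univ_nonempty).ne'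
  have hx : ∀ x, |∑ y, ∑ z, softmaxPolicy ψ θ x y * softmaxPolicy ψ θ x z *
        |⟪θ - θref, ψ (x, y) - ψ (x, z)⟫|
      - (∑ y, ∑ z, softmaxPolicy ψ θ' x y * softmaxPolicy ψ θ' x z *
        |⟪θ' - θref, ψ (x, y) - ψ (x, z)⟫|)|
      ≤ (2 * Bψ + 8 * D * Bψ ^ 2) * ‖θ - θ'‖ := fun x => by
    refine (abs_sum_mul_sub_le (L := 2 * Bψ * ‖θ - θ'‖) (M := 2 * D * Bψ)
      (T := 2 * (Bψ * ‖θ - θ'‖)) _ _ _ _ (hnonneg θ x) (hnonneg θ' x) (hone θ x) (hone θ' x)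
      (fun y z => ?_) (fun y z => ?_) (by positivity) ?_).trans_eq (by ring)
    · refine (abs_abs_sub_abs_le_abs_sub _ _).trans ?_
      rw [← inner_sub_left, sub_sub_sub_cancel_right, mul_comm]
      exact (abs_real_inner_le_norm _ _).trans
        (mul_le_mul_of_nonneg_left (hdiff x y z) (norm_nonneg _))
    · rw [abs_abs]
      exact (abs_real_inner_le_norm _ _).trans
        ((mul_le_mul hD' (hdiff x y z) (norm_nonneg _) hD0).trans_eq (by ring))
    · refine sum_abs_softmax_sub_le _ _ fun y => ?_
      rw [← inner_sub_left, mul_comm]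
      exact (abs_real_inner_le_norm _ _).trans
        (mul_le_mul_of_nonneg_left (hB x y) (norm_nonneg _))
  have hR : ∀ η, Rpen μ ψ θref η = ∑ x, μ x * ∑ y, ∑ z, softmaxPolicy ψ η x y *
      softmaxPolicy ψ η x z * |⟪η - θref, ψ (x, y) - ψ (x, z)⟫| := fun η => by
    simp only [Rpen, Finset.mul_sum, mul_assoc]
  rw [hR, hR, ← Finset.sum_sub_distrib]
  calc _ ≤ ∑ x, μ x * ((2 * Bψ + 8 * D * Bψ ^ 2) * ‖θ - θ'‖) := by
        refine (Finset.abs_sum_le_sum_abs _ _).trans (Finset.sum_le_sum fun x _ => ?_)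
        rw [← mul_sub, abs_mul, abs_of_nonneg (hμ x).1]
        exact mul_le_mul_of_nonneg_left (hx x) (hμ x).1
    _ = _ := by rw [← Finset.sum_mul, hμsum, one_mul]
end
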